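/- Let A > 0 and let N_0 ≥ max{1, A} be an integer. Suppose |ξ_q| ≤ A for all integers q ≥ N_0. Then for every integer p ≥ N_0 + 3: Σ_{p_1=N_0}^{p−3} ((p_1/p)²/(p−1)²) · |∏_{p_1<q<p} (1 + ξ_q/q³)^{p_1} − 1| ≤ A/(2p²). -/

import Mathlib

open Finset

lemma sum_Ioo_inv_cube_le (n : ℕ) (hn : 1 ≤ n) (m : ℕ) (hm : n + 1 ≤ m) :
    ∑ q ∈ Ioo n m, 1 / (q : ℝ) ^ 3 ≤
      (1 / ((n : ℝ) * (n + 1)) - 1 / (((m : ℝ) - 1) * m)) / 2 := by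
  induction m, hm using Nat.le_induction with
  | base =>
    have hIoo : Ioo n (n + 1) = ∅ := by
      ext q
      simp only [mem_Ioo, notMem_empty, iff_false]
      omega
    simp [hIoo, mul_comm]
  | succ m hm ih =>
    have hIoo : Ioo n (m + 1) = insert m (Ioo n m) := by
      ext q
      simp only [mem_Ioo, mem_insert]
      omega
    rw [hIoo, sum_insert (by simp)]
    have hm2 : (2 : ℝ) ≤ m := by exact_mod_cast (by omega : 2 ≤ m)
    have key : 1 / (m : ℝ) ^ 3 ≤
        (1 / (((m : ℝ) - 1) * m) - 1 / ((m : ℝ) * (m + 1))) / 2 := by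
      have h1 : (0 : ℝ) < (m : ℝ) - 1 := by linarith
      have h2 : (1 / (((m : ℝ) - 1) * m) - 1 / ((m : ℝ) * (m + 1))) / 2 =
          1 / (((m : ℝ) - 1) * m * (m + 1)) := by
        field_simp
        ring
      rw [h2]
      apply one_div_le_one_div_of_le (by positivity)
      nlinarith
    push_cast
    rw [add_sub_cancel_right]
    linarith

lemma abs_prod_one_add_pow_sub_one_le {ι : Type*} (s : Finset ι) (f : ι → ℝ) (n : ℕ) :
    |∏ i ∈ s, (1 + f i) ^ n - 1| ≤ Real.exp (n * ∑ i ∈ s, |f i|) - 1 := by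
  have h := Finset.norm_prod_one_add_sub_one_le (s ×ˢ range n) fun x => f x.1
  simpa [prod_product, sum_product, mul_sum] using h

lemma abs_prod_Ioo_sub_one_le (A : ℝ) (n p : ℕ) (hn : 1 ≤ n) (hA : A ≤ n) (ξ : ℕ → ℝ)
    (hξ : ∀ q : ℕ, n ≤ q → |ξ q| ≤ A) (hp : n + 1 ≤ p) :
    |(∏ q ∈ Ioo n p, (1 + ξ q / (q : ℝ) ^ 3) ^ n) - 1| ≤ A / (n + 1) := by
  have hA0 : 0 ≤ A := (abs_nonneg _).trans (hξ n le_rfl)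
  have hn1 : (1 : ℝ) ≤ n := by exact_mod_cast hn
  have hp2 : (2 : ℝ) ≤ p := by exact_mod_cast (by omega : 2 ≤ p)
  refine (abs_prod_one_add_pow_sub_one_le _ _ n).trans ?_
  set S := (n : ℝ) * ∑ q ∈ Ioo n p, |ξ q / (q : ℝ) ^ 3| with hS
  have hS0 : 0 ≤ S := by positivity
  have hsum : ∑ q ∈ Ioo n p, |ξ q / (q : ℝ) ^ 3| ≤ A * ∑ q ∈ Ioo n p, 1 / (q : ℝ) ^ 3 := by
    rw [mul_sum]
    refine sum_le_sum fun q hq => ?_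
    rw [abs_div, abs_of_nonneg (by positivity : (0 : ℝ) ≤ (q : ℝ) ^ 3), mul_one_div]
    gcongr
    exact hξ q (mem_Ioo.1 hq).1.le
  have hcube : ∑ q ∈ Ioo n p, 1 / (q : ℝ) ^ 3 ≤ 1 / ((n : ℝ) * (n + 1)) / 2 := by
    refine (sum_Ioo_inv_cube_le n hn p hp).trans ?_
    have : 0 ≤ 1 / (((p : ℝ) - 1) * p) :=
      one_div_nonneg.2 (mul_nonneg (by linarith) (by linarith))
    linarith
  have hSle : S ≤ A / (n + 1) / 2 := by
    calc S ≤ n * (A * (1 / ((n : ℝ) * (n + 1)) / 2)) := by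
          rw [hS]
          gcongr
          exact hsum.trans (by gcongr)
      _ = A / (n + 1) / 2 := by field_simp
  have hA1 : A / ((n : ℝ) + 1) ≤ 1 := by
    rw [div_le_one (by positivity)]
    linarith
  have hexp := Real.abs_exp_sub_one_le (x := S) (by rw [abs_of_nonneg hS0]; linarith)
  rw [abs_of_nonneg hS0] at hexp
  linarith [le_abs_self (Real.exp S - 1)]

lemma sum_Icc_natCast_le (a p : ℕ) (hp : 3 ≤ p) :
    ∑ n ∈ Icc a (p - 3), (n : ℝ) ≤ ((p : ℝ) - 1) ^ 2 / 2 := by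
  obtain ⟨m, rfl⟩ := Nat.exists_eq_add_of_le' hp
  have h : ∑ n ∈ Icc a m, (n : ℝ) ≤ ∑ n ∈ range (m + 1), (n : ℝ) := by
    refine sum_le_sum_of_subset_of_nonneg (fun x hx => ?_) fun _ _ _ => by positivity
    simp only [mem_Icc, mem_range] at hx ⊢
    omega
  have h2 : (∑ n ∈ range (m + 1), (n : ℝ)) * 2 = (m + 1) * m := by
    have := congrArg (Nat.cast (R := ℝ)) (sum_range_id_mul_two (m + 1))
    rw [Nat.add_sub_cancel] at this
    push_cast at this
    exact this
  have hm : (0 : ℝ) ≤ m := m.cast_nonneg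
  rw [Nat.add_sub_cancel]
  push_cast
  nlinarith

/-- Lemma 6.4: if `|ξ_q| ≤ A` for `q ≥ N₀ ≥ max{1, A}`, then for `p ≥ N₀+3`:
`Σ_{p₁=N₀}^{p−3} ((p₁/p)²/(p−1)²) |∏_{p₁<q<p} (1+ξ_q/q³)^{p₁} − 1| ≤ A/(2p²)`. -/
theorem stmt_13 (A : ℝ) (hA : 0 < A) (N₀ : ℕ) (hN₀1 : 1 ≤ N₀) (hN₀A : A ≤ (N₀ : ℝ))
    (ξ : ℕ → ℝ) (hξ : ∀ q : ℕ, N₀ ≤ q → |ξ q| ≤ A)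
    (p : ℕ) (hp : N₀ + 3 ≤ p) :
    ∑ p1 ∈ Finset.Icc N₀ (p - 3),
        (((p1 : ℝ) / (p : ℝ)) ^ 2 / ((p : ℝ) - 1) ^ 2) *
          |(∏ q ∈ Finset.Ioo p1 p, (1 + ξ q / (q : ℝ) ^ 3) ^ p1) - 1|
      ≤ A / (2 * (p : ℝ) ^ 2) := by
  have hp3 : (3 : ℝ) ≤ p := by exact_mod_cast (by omega : 3 ≤ p)
  have hp1 : (0 : ℝ) < (p : ℝ) - 1 := by linarith
  calc _ ≤ ∑ n ∈ Icc N₀ (p - 3), A / ((p : ℝ) ^ 2 * ((p : ℝ) - 1) ^ 2) * n := by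
        refine sum_le_sum fun n hn => ?_
        obtain ⟨hn, hnp⟩ := mem_Icc.1 hn
        have hNn : (N₀ : ℝ) ≤ n := by exact_mod_cast hn
        calc _ ≤ ((n : ℝ) / p) ^ 2 / ((p : ℝ) - 1) ^ 2 * (A / (n + 1)) := by
              gcongr
              exact abs_prod_Ioo_sub_one_le A n p (by omega) (hN₀A.trans hNn) ξ
                (fun q hq => hξ q (hn.trans hq)) (by omega)
          _ = A / ((p : ℝ) ^ 2 * ((p : ℝ) - 1) ^ 2) * ((n : ℝ) ^ 2 / (n + 1)) := by
              field_simp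
          _ ≤ _ := by
              gcongr
              rw [div_le_iff₀ (by positivity)]
              nlinarith [(n.cast_nonneg : (0 : ℝ) ≤ n)]
    _ ≤ A / ((p : ℝ) ^ 2 * ((p : ℝ) - 1) ^ 2) * (((p : ℝ) - 1) ^ 2 / 2) := by
        rw [← mul_sum]
        gcongr
        exact sum_Icc_natCast_le N₀ p (by omega)
    _ = A / (2 * (p : ℝ) ^ 2) := by
        field_simp
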